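/- arXiv:0709.2334 — 2 statements merged into one kernel-verified Lean document; each statement's English description precedes it below -/
import Mathlib

section
/- Let k be a field and let G be a polycyclic-by-finite group, i.e., G has a finite series 1 = G₀ ⊆ G₁ ⊆ … ⊆ Gₙ = G of subgroups with G_i normal in G_{i+1} and each quotient G_{i+1}/G_i cyclic or finite. Then the group algebra kG is a noetherian ring. -/
/-!
STATEMENT 2 (P. Hall):
If `G` is a polycyclic-by-finite group, then the group algebra `kG` is a noetherian
ring (all left ideals and all right ideals are finitely generated).
-/

universe u v

/-- A group `G` is polycyclic-by-finite if it has a finite subnormal series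
`1 = G₀ ⊆ G₁ ⊆ … ⊆ Gₙ = G` with `Gᵢ` normal in `Gᵢ₊₁` and each quotient `Gᵢ₊₁/Gᵢ`
cyclic or finite.  Here "the quotient `Gᵢ₊₁/Gᵢ` is cyclic" is expressed by saying
that `Gᵢ₊₁` is generated by `Gᵢ` together with a single element, and "the quotient
is finite" by saying that `Gᵢ` has finite (i.e. nonzero) relative index in `Gᵢ₊₁`. -/
def IsPolycyclicByFinite (G : Type v) [Group G] : Prop :=
  ∃ (n : ℕ) (c : Fin (n + 1) → Subgroup G),
    c 0 = ⊥ ∧ c (Fin.last n) = ⊤ ∧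
    ∀ i : Fin n,
      c i.castSucc ≤ c i.succ ∧
      ((c i.castSucc).subgroupOf (c i.succ)).Normal ∧
      ((∃ g : G, g ∈ c i.succ ∧ c i.succ = c i.castSucc ⊔ Subgroup.zpowers g) ∨
        (c i.castSucc).relIndex (c i.succ) ≠ 0)

theorem wellFoundedGT_natOrderHom (α : Type*) [PartialOrder α] [WellFoundedGT α] :
    WellFoundedGT (ℕ →o α) := by
  rw [wellFoundedGT_iff_monotone_chain_condition]
  intro a
  have stab := wellFoundedGT_iff_monotone_chain_condition.mp ‹WellFoundedGT α›
  obtain ⟨N, hN⟩ := stab ⟨fun n => a n n, fun i j h =>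
    ((a i).monotone h).trans (a.monotone h j)⟩
  have hN' : ∀ m, N ≤ m → a N N = a m m := hN
  choose M hM using fun i => stab ⟨fun n => a n i, fun _ _ h => a.monotone h i⟩
  have hM' : ∀ i m, M i ≤ m → a (M i) i = a m i := hM
  refine ⟨N + ∑ i ∈ Finset.range N, M i, fun m hm => OrderHom.ext _ _ (funext fun i => ?_)⟩
  rcases lt_or_ge i N with hi | hi
  · have hle : M i ≤ N + ∑ i ∈ Finset.range N, M i :=
      (Finset.single_le_sum (f := M) (fun _ _ => Nat.zero_le _) (Finset.mem_range.mpr hi)).trans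
        (Nat.le_add_left _ _)
    exact (hM' i _ hle).symm.trans (hM' i _ (hle.trans hm))
  · have key : ∀ n, N ≤ n → a N N = a n i := fun n hn => by
      apply le_antisymm ((a.monotone hn N).trans ((a n).monotone hi))
      calc a n i ≤ a (max n i) (max n i) :=
            (a.monotone (le_max_left n i) i).trans ((a _).monotone (le_max_right n i))
        _ = a N N := (hN' _ (hn.trans (le_max_left n i))).symm
    exact (key _ (Nat.le_add_right _ _)).symm.trans (key m (by omega))

section LaurentExtension

variable {S R : Type*} [Ring S] [Ring R] {φ : S →+* R} {σ : S ≃+* S} {x : Rˣ}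

theorem map_mul_unit_pow (hσ : ∀ s, φ s * x = x * φ (σ s)) (i : ℕ) (s : S) :
    φ s * (x : R) ^ i = (x : R) ^ i * φ ((σ ^ i) s) := by
  induction i generalizing s with
  | zero => simp
  | succ i ih => rw [pow_succ', ← mul_assoc, hσ, mul_assoc, ih, ← mul_assoc, pow_succ]; rfl

/-- The ideal of coefficients at `x ^ n` of the elements of `I` that are right polynomials in `x`
of degree at most `n` over the image of `S`. -/
def leadingCoeffIdeal (hσ : ∀ s, φ s * x = x * φ (σ s)) (I : Ideal R) (n : ℕ) : Ideal S where
  carrier := {s | ∃ a : ℕ → S, a n = s ∧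
    ∑ i ∈ Finset.range (n + 1), (x : R) ^ i * φ (a i) ∈ I}
  zero_mem' := ⟨0, rfl, by simp⟩
  add_mem' := by
    rintro _ _ ⟨a, rfl, ha⟩ ⟨b, rfl, hb⟩
    exact ⟨a + b, rfl, by simpa [mul_add, Finset.sum_add_distrib] using I.add_mem ha hb⟩
  smul_mem' := by
    rintro t _ ⟨a, rfl, ha⟩
    refine ⟨fun i => (σ ^ i) ((σ ^ n).symm t) * a i, by simp, ?_⟩
    convert I.mul_mem_left (φ ((σ ^ n).symm t)) ha using 1
    rw [Finset.mul_sum]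
    refine Finset.sum_congr rfl fun i _ => ?_
    rw [← mul_assoc, map_mul_unit_pow hσ, map_mul, mul_assoc]

theorem leadingCoeffIdeal_mono_right (hσ : ∀ s, φ s * x = x * φ (σ s)) (I : Ideal R) :
    Monotone (leadingCoeffIdeal hσ I) := by
  refine monotone_nat_of_le_succ fun n => ?_
  rintro _ ⟨a, rfl, ha⟩
  refine ⟨fun i => Nat.casesOn i 0 a, rfl, ?_⟩
  rw [Finset.sum_range_succ']
  convert I.mul_mem_left (x : R) ha using 1
  simp [Finset.mul_sum, pow_succ', mul_assoc]

theorem leadingCoeffIdeal_mono_left (hσ : ∀ s, φ s * x = x * φ (σ s)) {I J : Ideal R}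
    (h : I ≤ J) (n : ℕ) :
    leadingCoeffIdeal hσ I n ≤ leadingCoeffIdeal hσ J n := by
  rintro _ ⟨a, rfl, ha⟩
  exact ⟨a, rfl, h ha⟩

theorem sum_mem_of_leadingCoeffIdeal_le (hσ : ∀ s, φ s * x = x * φ (σ s)) {I J : Ideal R}
    (h : I ≤ J)
    (hL : ∀ n, leadingCoeffIdeal hσ J n ≤ leadingCoeffIdeal hσ I n) (n : ℕ) :
    ∀ a : ℕ → S, ∑ i ∈ Finset.range n, (x : R) ^ i * φ (a i) ∈ J →
      ∑ i ∈ Finset.range n, (x : R) ^ i * φ (a i) ∈ I := by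
  induction n with
  | zero => simp
  | succ n ih =>
    intro a ha
    obtain ⟨b, hb, hbI⟩ := hL n ⟨a, rfl, ha⟩
    have hab : ∑ i ∈ Finset.range (n + 1), (x : R) ^ i * φ (a i) -
        ∑ i ∈ Finset.range (n + 1), (x : R) ^ i * φ (b i) =
        ∑ i ∈ Finset.range n, (x : R) ^ i * φ ((a - b) i) := by
      simp [Finset.sum_range_succ, hb, mul_sub]
    have := ih (a - b) (hab ▸ J.sub_mem ha (h hbI))
    rw [← hab] at this
    exact (I.sub_mem_iff_left hbI).mp this

theorem exists_sum_range_of_mem_closure {r : R}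
    (hr : r ∈ AddSubgroup.closure {r | ∃ (i : ℕ) (s : S), r = (x : R) ^ i * φ s}) :
    ∃ (n : ℕ) (a : ℕ → S), r = ∑ i ∈ Finset.range n, (x : R) ^ i * φ (a i) := by
  suffices h : AddSubgroup.closure {r | ∃ (i : ℕ) (s : S), r = (x : R) ^ i * φ s} ≤
      (Finsupp.liftAddHom fun i : ℕ =>
        (AddMonoidHom.mulLeft ((x : R) ^ i)).comp φ.toAddMonoidHom).range by
    obtain ⟨f, rfl⟩ := h hr
    refine ⟨f.support.sup id + 1, f, ?_⟩
    rw [Finsupp.liftAddHom_apply, Finsupp.sum_of_support_subset]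
    · rfl
    · exact fun i hi => Finset.mem_range.mpr (Nat.lt_succ_of_le (Finset.le_sup (f := id) hi))
    · simp
  rw [AddSubgroup.closure_le]
  rintro _ ⟨i, s, rfl⟩
  exact ⟨Finsupp.single i s, by simp⟩

theorem pow_mul_mem_closure {r : R}
    (hr : r ∈ AddSubgroup.closure {r | ∃ (i : ℕ) (s : S), r = (x : R) ^ i * φ s}) (m : ℕ) :
    (x : R) ^ m * r ∈ AddSubgroup.closure {r | ∃ (i : ℕ) (s : S), r = (x : R) ^ i * φ s} := by
  induction hr using AddSubgroup.closure_induction with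
  | mem _ h =>
    obtain ⟨i, s, rfl⟩ := h
    exact AddSubgroup.subset_closure ⟨m + i, s, by rw [pow_add, mul_assoc]⟩
  | zero => simp
  | add _ _ _ _ h h' => rw [mul_add]; exact add_mem h h'
  | neg _ _ h => rw [mul_neg]; exact neg_mem h

theorem exists_pow_mul_mem_closure {r : R}
    (hr : r ∈ AddSubgroup.closure {r | ∃ (j : ℤ) (s : S), r = ↑(x ^ j) * φ s}) :
    ∃ m : ℕ, (x : R) ^ m * r ∈
      AddSubgroup.closure {r | ∃ (i : ℕ) (s : S), r = (x : R) ^ i * φ s} := by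
  induction hr using AddSubgroup.closure_induction with
  | mem _ h =>
    obtain ⟨j, s, rfl⟩ := h
    refine ⟨j.natAbs, AddSubgroup.subset_closure ⟨(j.natAbs + j).toNat, s, ?_⟩⟩
    rw [← mul_assoc, ← Units.val_pow_eq_pow_val, ← Units.val_pow_eq_pow_val, ← Units.val_mul,
      ← zpow_natCast, ← zpow_natCast, ← zpow_add]
    congr 4
    omega
  | zero => exact ⟨0, by simp⟩
  | add a b _ _ ha hb =>
    obtain ⟨m, hm⟩ := ha
    obtain ⟨n, hn⟩ := hb
    refine ⟨m + n, ?_⟩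
    rw [mul_add]
    refine add_mem ?_ ?_
    · rw [add_comm m n, pow_add, mul_assoc]
      exact pow_mul_mem_closure hm n
    · rw [pow_add, mul_assoc]
      exact pow_mul_mem_closure hn m
  | neg a _ ha =>
    obtain ⟨m, hm⟩ := ha
    exact ⟨m, by rw [mul_neg]; exact neg_mem hm⟩

/-- A ring generated additively by the products `x ^ j * s` with `j : ℤ` and `s` in a left
noetherian ring normalized by the unit `x` is left noetherian. -/
theorem IsNoetherianRing.of_closure_zpow_mul_eq_top [IsNoetherianRing S]
    (hσ : ∀ s, φ s * x = x * φ (σ s))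
    (hgen : AddSubgroup.closure {r | ∃ (j : ℤ) (s : S), r = ↑(x ^ j) * φ s} = ⊤) :
    IsNoetherianRing R := by
  have := wellFoundedGT_natOrderHom (Ideal S)
  rw [isNoetherianRing_iff, isNoetherian_iff']
  refine StrictMono.wellFoundedGT (β := ℕ →o Ideal S)
    (f := fun I => ⟨_, leadingCoeffIdeal_mono_right hσ I⟩) fun I J hIJ => ?_
  refine lt_of_le_not_ge (fun n => leadingCoeffIdeal_mono_left hσ hIJ.le n) fun hL => ?_
  refine hIJ.not_ge fun r (hr : r ∈ J) => ?_
  obtain ⟨m, hm⟩ := exists_pow_mul_mem_closure (hgen ▸ AddSubgroup.mem_top r)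
  obtain ⟨n, a, ha⟩ := exists_sum_range_of_mem_closure hm
  have hI : (x : R) ^ m * r ∈ I := by
    rw [ha]
    apply sum_mem_of_leadingCoeffIdeal_le hσ hIJ.le hL
    rw [← ha]
    exact Ideal.mul_mem_left J _ hr
  have := Ideal.mul_mem_left I (↑(x ^ m)⁻¹ : R) hI
  rwa [← Units.val_pow_eq_pow_val, Units.inv_mul_cancel_left] at this

end LaurentExtension

namespace MonoidAlgebra

variable {k : Type*} [Ring k] {G : Type*} [Group G]

theorem isNoetherianRing_of_normal_sup_zpowers (H : Subgroup G) [H.Normal] (g : G)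
    (hg : H ⊔ Subgroup.zpowers g = ⊤) [IsNoetherianRing (MonoidAlgebra k H)] :
    IsNoetherianRing (MonoidAlgebra k G) := by
  let x : (MonoidAlgebra k G)ˣ := Units.map (of k G) (toUnits g)
  have hx : ∀ j : ℤ, (↑(x ^ j) : MonoidAlgebra k G) = single (g ^ j) 1 := fun j => by
    rw [← map_zpow, ← map_zpow]; rfl
  refine IsNoetherianRing.of_closure_zpow_mul_eq_top (φ := mapDomainRingHom k H.subtype)
    (σ := mapDomainRingEquiv k (MulAut.conjNormal g⁻¹)) (x := x) (fun s => ?_) ?_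
  · have hx1 : (x : MonoidAlgebra k G) = single g 1 := rfl
    induction s using induction_linear with
    | zero => simp
    | add a b ha hb => simp only [map_add, add_mul, mul_add, ha, hb]
    | single h r => simp [hx1, single_mul_single, mul_assoc]
  · refine eq_top_iff.mpr fun r _ => ?_
    induction r using induction_linear with
    | zero => exact zero_mem _
    | add a b ha hb => exact add_mem (ha trivial) (hb trivial)
    | single y c =>
      have hy : y ∈ Subgroup.zpowers g ⊔ H := by rw [sup_comm, hg]; trivial
      obtain ⟨_, ⟨j, rfl⟩, h, hh, rfl⟩ := Subgroup.mem_sup_of_normal_right.mp hy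
      exact AddSubgroup.subset_closure ⟨j, single ⟨h, hh⟩ c, by simp [hx, single_mul_single]⟩

theorem isNoetherianRing_of_index_ne_zero (H : Subgroup G) (hH : H.index ≠ 0)
    [IsNoetherianRing (MonoidAlgebra k H)] : IsNoetherianRing (MonoidAlgebra k G) := by
  have := Subgroup.index_ne_zero_iff_finite.mp hH
  let φ := mapDomainRingHom k H.subtype
  let : Module (MonoidAlgebra k H) (MonoidAlgebra k G) := Module.compHom _ φ
  have smul_def : ∀ (s : MonoidAlgebra k H) (r : MonoidAlgebra k G), s • r = φ s * r :=
    fun _ _ => rfl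
  have : IsScalarTower (MonoidAlgebra k H) (MonoidAlgebra k G) (MonoidAlgebra k G) :=
    ⟨fun s r t => by simp only [smul_def, smul_eq_mul, mul_assoc]⟩
  have : Module.Finite (MonoidAlgebra k H) (MonoidAlgebra k G) := by
    refine ⟨Submodule.fg_def.mpr
      ⟨Set.range fun q : G ⧸ H => single q.out⁻¹ 1, Set.finite_range _, ?_⟩⟩
    refine eq_top_iff.mpr fun r _ => ?_
    induction r using induction_linear with
    | zero => exact zero_mem _
    | add a b ha hb => exact add_mem (ha trivial) (hb trivial)
    | single y c =>
      obtain ⟨h, hh⟩ := QuotientGroup.mk_out_eq_mul H y⁻¹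
      convert Submodule.smul_mem _ (single h c)
        (Submodule.subset_span (Set.mem_range_self ((y⁻¹ : G) : G ⧸ H))) using 1
      simp [smul_def, φ, single_mul_single, hh]
  exact .of_finite (MonoidAlgebra k H) _

end MonoidAlgebra

theorem IsPolycyclicByFinite.isNoetherianRing_monoidAlgebra {G : Type*} [Group G]
    (hG : IsPolycyclicByFinite G) (k : Type*) [Ring k] [IsNoetherianRing k] :
    IsNoetherianRing (MonoidAlgebra k G) := by
  obtain ⟨n, c, h0, hn, hc⟩ := hG
  suffices h : ∀ i, IsNoetherianRing (MonoidAlgebra k (c i)) by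
    have := h (Fin.last n)
    rw [hn] at this
    exact isNoetherianRing_of_ringEquiv _
      (MonoidAlgebra.mapDomainRingEquiv k (Subgroup.topEquiv (G := G)))
  intro i
  induction i using Fin.induction with
  | zero =>
    rw [h0]
    exact isNoetherianRing_of_ringEquiv k (MonoidAlgebra.uniqueRingEquiv (⊥ : Subgroup G)).symm
  | succ i ih =>
    obtain ⟨hle, hnormal, hquot⟩ := hc i
    have := isNoetherianRing_of_ringEquiv _
      (MonoidAlgebra.mapDomainRingEquiv k (Subgroup.subgroupOfEquivOfLe hle).symm)
    rcases hquot with ⟨g, hg, heq⟩ | hfin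
    · refine MonoidAlgebra.isNoetherianRing_of_normal_sup_zpowers
        ((c i.castSucc).subgroupOf (c i.succ)) ⟨g, hg⟩ ?_
      have hz : Subgroup.zpowers (⟨g, hg⟩ : c i.succ) =
          (Subgroup.zpowers g).subgroupOf (c i.succ) := by
        ext y
        simp [Subgroup.mem_subgroupOf, Subgroup.mem_zpowers_iff, Subtype.ext_iff]
      rw [hz, ← Subgroup.subgroupOf_sup hle (by simpa using hg), ← heq, Subgroup.subgroupOf_self]
    · exact MonoidAlgebra.isNoetherianRing_of_index_ne_zero _ hfin

theorem group_algebra_noetherian_of_polycyclicByFinite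
    (k : Type u) [Field k] (G : Type v) [Group G]
    (hG : IsPolycyclicByFinite G) :
    IsNoetherianRing (MonoidAlgebra k G) ∧ IsNoetherianRing (MonoidAlgebra k G)ᵐᵒᵖ := by
  refine ⟨hG.isNoetherianRing_monoidAlgebra k, ?_⟩
  have := hG.isNoetherianRing_monoidAlgebra kᵐᵒᵖ
  exact isNoetherianRing_of_ringEquiv _
    ((MonoidAlgebra.mapDomainRingEquiv kᵐᵒᵖ (MulEquiv.inv' G)).trans
      MonoidAlgebra.opRingEquiv.symm)
end

section
/- Let k be a field and let G be a group. The group algebra kG is a noetherian ring satisfying a polynomial identity if and only if G is a finitely generated abelian-by-finite group, i.e., G is finitely generated and has an abelian subgroup of finite index. -/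
/-!
STATEMENT 9:
For a group `G` and a field `k`, the group algebra `kG` is a noetherian ring
satisfying a polynomial identity if and only if `G` is a finitely generated
abelian-by-finite group.
-/

universe u v

/-- An algebra `A` over `k` satisfies a polynomial identity if there is a nonzero
polynomial `f` in finitely many noncommuting variables, with coefficients in `k`,
which vanishes identically on `A`. -/
def SatisfiesPolynomialIdentity (k : Type u) (A : Type v) [CommSemiring k] [Ring A]
    [Algebra k A] : Prop :=
  ∃ (n : ℕ) (f : FreeAlgebra k (Fin n)), f ≠ 0 ∧
    ∀ v : Fin n → A, FreeAlgebra.lift k v f = 0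

open scoped Pointwise

/-- A subset of a group is coset-small if it is covered by finitely many left cosets of subgroups
of infinite index. -/
def IsCosetSmall {G : Type*} [Group G] (S : Set G) : Prop :=
  ∃ t : Finset (G × Subgroup G), (∀ p ∈ t, ¬ p.2.FiniteIndex) ∧
    S ⊆ ⋃ p ∈ t, p.1 • (p.2 : Set G)

section CosetSmall

variable {G : Type*} [Group G]

lemma IsCosetSmall.mono {S T : Set G} (hT : IsCosetSmall T) (h : S ⊆ T) : IsCosetSmall S := by
  obtain ⟨t, ht, hs⟩ := hT
  exact ⟨t, ht, h.trans hs⟩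

lemma IsCosetSmall.empty : IsCosetSmall (∅ : Set G) := ⟨∅, by simp, by simp⟩

lemma IsCosetSmall.union {S T : Set G} (hS : IsCosetSmall S) (hT : IsCosetSmall T) :
    IsCosetSmall (S ∪ T) := by
  classical
  obtain ⟨s, hs, hS⟩ := hS
  obtain ⟨t, ht, hT⟩ := hT
  refine ⟨s ∪ t, fun p hp => ?_, ?_⟩
  · rcases Finset.mem_union.1 hp with h | h
    exacts [hs p h, ht p h]
  · rw [Finset.set_biUnion_union]
    exact Set.union_subset_union hS hT

lemma IsCosetSmall.biUnion {ι : Type*} {s : Set ι} (hs : s.Finite) {S : ι → Set G}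
    (h : ∀ i ∈ s, IsCosetSmall (S i)) : IsCosetSmall (⋃ i ∈ s, S i) := by
  induction s, hs using Set.Finite.induction_on with
  | empty => simpa using IsCosetSmall.empty
  | @insert a s _ _ ih =>
    rw [Set.biUnion_insert]
    exact (h a (by simp)).union (ih fun i hi => h i (by simp [hi]))

lemma isCosetSmall_smul {H : Subgroup G} (hH : ¬ H.FiniteIndex) (g : G) :
    IsCosetSmall (g • (H : Set G)) :=
  ⟨{(g, H)}, by simpa using hH, by simp⟩

lemma IsCosetSmall.ne_univ {S : Set G} (hS : IsCosetSmall S) : S ≠ Set.univ := by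
  rintro rfl
  obtain ⟨t, ht, hS⟩ := hS
  obtain ⟨p, hp, hfin⟩ := Subgroup.exists_finiteIndex_of_leftCoset_cover
    (s := t) (g := Prod.fst) (H := Prod.snd) (Set.univ_subset_iff.1 hS)
  exact ht p hp hfin

lemma finiteIndex_centralizer_conj {x : G} (g : G)
    (h : (Subgroup.centralizer {x}).FiniteIndex) :
    (Subgroup.centralizer {g * x * g⁻¹}).FiniteIndex := by
  have hmap : (Subgroup.centralizer {x}).map (MulAut.conj g).toMonoidHom ≤
      Subgroup.centralizer {g * x * g⁻¹} := by
    rintro _ ⟨y, hy, rfl⟩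
    have hy := Subgroup.mem_centralizer_singleton_iff.1 hy
    rw [Subgroup.mem_centralizer_singleton_iff]
    simp only [MulEquiv.toMonoidHom_eq_coe, MonoidHom.coe_coe, MulAut.conj_apply]
    calc _ = g * (y * x) * g⁻¹ := by group
      _ = _ := by rw [hy]; group
  have : ((Subgroup.centralizer {x}).map (MulAut.conj g).toMonoidHom).FiniteIndex := by
    refine ⟨?_⟩
    rw [MulEquiv.toMonoidHom_eq_coe, Subgroup.index_map_equiv]
    exact h.index_ne_zero
  exact Subgroup.finiteIndex_of_le hmap

variable (G) in
/-- The FC-center: the subgroup of elements with finitely many conjugates. -/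
def fcCenter : Subgroup G where
  carrier := {x | (Subgroup.centralizer {x}).FiniteIndex}
  one_mem' := by
    have : Subgroup.centralizer {(1 : G)} = ⊤ := by
      ext y; simp [Subgroup.mem_centralizer_singleton_iff]
    simp only [Set.mem_ofPred_eq, this]
    infer_instance
  mul_mem' {x y} hx hy := by
    simp only [Set.mem_ofPred_eq] at *
    refine Subgroup.finiteIndex_of_le
      (H := Subgroup.centralizer {x} ⊓ Subgroup.centralizer {y}) fun z hz => ?_
    have h1 := Subgroup.mem_centralizer_singleton_iff.1 hz.1
    have h2 := Subgroup.mem_centralizer_singleton_iff.1 hz.2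
    rw [Subgroup.mem_centralizer_singleton_iff, ← mul_assoc, h1, mul_assoc, h2, mul_assoc]
  inv_mem' {x} hx := by
    simp only [Set.mem_ofPred_eq] at *
    refine Subgroup.finiteIndex_of_le (H := Subgroup.centralizer {x}) fun z hz => ?_
    have h1 : Commute z x := Subgroup.mem_centralizer_singleton_iff.1 hz
    exact Subgroup.mem_centralizer_singleton_iff.2 h1.inv_right.eq

lemma mem_fcCenter {x : G} : x ∈ fcCenter G ↔ (Subgroup.centralizer {x}).FiniteIndex := Iff.rfl

instance : (fcCenter G).Normal := ⟨fun _ hx g => finiteIndex_centralizer_conj g hx⟩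

lemma isCosetSmall_mul_mem_fcCenter (h : ¬ (fcCenter G).FiniteIndex) (p q : G) :
    IsCosetSmall {x | p * x * q ∈ fcCenter G} := by
  refine (isCosetSmall_smul h (p⁻¹ * q⁻¹)).mono fun x hx => ?_
  rw [Set.mem_smul_set_iff_inv_smul_mem]
  have := (inferInstance : (fcCenter G).Normal).conj_mem _ hx q
  simpa [mul_assoc] using this

lemma isCosetSmall_mul_eq_mul {p : G} (hp : p ∉ fcCenter G) (c : G) :
    IsCosetSmall {x | p * x = x * c} := by
  rcases Set.eq_empty_or_nonempty {x | p * x = x * c} with h | ⟨y, hy⟩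
  · rw [h]; exact .empty
  have hc : c = y⁻¹ * p * y := by rw [mul_assoc, show p * y = y * c from hy]; simp
  have hp' : ¬ (Subgroup.centralizer {c}).FiniteIndex := fun hfin => hp <| by
    have := finiteIndex_centralizer_conj y hfin
    rwa [show y * c * y⁻¹ = p by rw [hc]; group] at this
  refine (isCosetSmall_smul hp' y).mono fun x hx => ?_
  rw [Set.mem_smul_set_iff_inv_smul_mem, SetLike.mem_coe,
    Subgroup.mem_centralizer_singleton_iff, smul_eq_mul]
  have hx : p * x = x * c := hx
  rw [mul_assoc, ← hx, hc]; group

/-- If the FC-center has infinite index, there are arbitrarily long sequences of group elements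
all of whose nontrivial rearrangements have a different product. -/
lemma exists_generic_of_not_finiteIndex_fcCenter {ι : Type*} [DecidableEq ι]
    (h : ¬ (fcCenter G).FiniteIndex) (L : List ι) (hL : L.Nodup) :
    ∃ g : ι → G, (∀ l : List ι, l.Nodup → l ⊆ L → l ≠ [] → (l.map g).prod ∉ fcCenter G) ∧
      ∀ l : List ι, l.Perm L → (l.map g).prod = (L.map g).prod → l = L := by
  induction L with
  | nil => exact ⟨1, fun l _ hl hne => absurd (List.subset_nil.1 hl) hne, by simp⟩
  | cons a L ih =>
    obtain ⟨haL, hL⟩ := List.nodup_cons.1 hL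
    obtain ⟨g, hg₁, hg₂⟩ := ih hL
    set s : Set (List ι) := {l | l.Nodup ∧ l ⊆ L} with hs
    have hsfin : s.Finite := by
      refine (List.finite_toSet (L.sublists.flatMap List.permutations)).subset fun l hl => ?_
      simp only [Set.mem_ofPred_eq, List.mem_flatMap, List.mem_sublists, List.mem_permutations]
      obtain ⟨l', hl', hsub⟩ := List.subperm_of_subset hl.1 hl.2
      exact ⟨l', hsub, hl'.symm⟩
    set P : List ι → G := fun l => (l.map g).prod
    obtain ⟨x, hx⟩ : ∃ x, x ∉ (⋃ l ∈ s, ⋃ m ∈ s, {x | P l * x * P m ∈ fcCenter G}) ∪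
        ⋃ l ∈ {l ∈ s | l ≠ []}, ⋃ m ∈ s, {x | P l * x = x * (P L * (P m)⁻¹)} := by
      refine (Set.ne_univ_iff_exists_notMem _).1 (IsCosetSmall.ne_univ (.union ?_ ?_))
      · exact .biUnion hsfin fun l _ => .biUnion hsfin fun m _ =>
          isCosetSmall_mul_mem_fcCenter h _ _
      · exact .biUnion (hsfin.subset fun l hl => hl.1) fun l hl => .biUnion hsfin fun m _ =>
          isCosetSmall_mul_eq_mul (hg₁ l hl.1.1 hl.1.2 hl.2) _
    simp only [Set.mem_union, Set.mem_iUnion, not_or, not_exists, Set.mem_ofPred_eq] at hx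
    obtain ⟨hx₁, hx₂⟩ := hx
    have hmap : ∀ l : List ι, a ∉ l → l.map (Function.update g a x) = l.map g := fun l hl =>
      List.map_congr_left fun b hb => Function.update_of_ne (by rintro rfl; exact hl hb) _ _
    have hsplit : ∀ l : List ι, l.Nodup → l ⊆ a :: L → a ∈ l →
        ∃ l₁ ∈ s, ∃ l₂ ∈ s, l = l₁ ++ a :: l₂ ∧ a ∉ l₁ ∧ a ∉ l₂ := by
      intro l hl hlL hal
      obtain ⟨l₁, l₂, rfl⟩ := List.append_of_mem hal
      have hn := List.nodup_middle.1 hl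
      have hn' := List.nodup_cons.1 hn
      simp only [List.mem_append, not_or] at hn'
      refine ⟨l₁, ⟨hn'.2.of_append_left, fun b hb => ?_⟩, l₂,
        ⟨hn'.2.of_append_right, fun b hb => ?_⟩, rfl, hn'.1.1, hn'.1.2⟩
      · rcases List.mem_cons.1 (hlL (show b ∈ l₁ ++ a :: l₂ by simp [hb])) with rfl | h
        exacts [absurd hb hn'.1.1, h]
      · rcases List.mem_cons.1 (hlL (show b ∈ l₁ ++ a :: l₂ by simp [hb])) with rfl | h
        exacts [absurd hb hn'.1.2, h]
    refine ⟨Function.update g a x, fun l hl hlL hne => ?_, fun l hl heq => ?_⟩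
    · by_cases hal : a ∈ l
      · obtain ⟨l₁, h₁, l₂, h₂, rfl, hn₁, hn₂⟩ := hsplit l hl hlL hal
        have := hx₁ l₁ h₁ l₂ h₂
        simpa [hmap _ hn₁, hmap _ hn₂, ← mul_assoc] using this
      · rw [hmap l hal]
        refine hg₁ l hl (fun b hb => ?_) hne
        rcases List.mem_cons.1 (hlL hb) with rfl | h
        exacts [absurd hb hal, h]
    · obtain ⟨l₁, h₁, l₂, h₂, rfl, hn₁, hn₂⟩ := hsplit l
        (hl.nodup_iff.2 (List.nodup_cons.2 ⟨haL, hL⟩)) hl.subset (hl.mem_iff.2 (by simp))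
      have heq : P l₁ * (x * P l₂) = x * P L := by
        simpa [hmap _ hn₁, hmap _ hn₂, hmap _ haL] using heq
      rcases eq_or_ne l₁ [] with rfl | hne
      · rw [List.nil_append, hg₂ l₂ (List.perm_cons a |>.1 hl) (by simpa [P] using heq)]
      · refine absurd ?_ (hx₂ l₁ ⟨h₁, hne⟩ l₂ h₂)
        rw [← mul_assoc x, ← heq]; group

end CosetSmall
section Multilinearization

lemma sum_neg_one_pow_smul_list_prod {A ι : Type*} [Ring A] {d m : ℕ} (u : Fin m → ι)
    (y : ι → Fin d → A) :
    ∑ S : Finset (Fin d), ((-1 : ℤ) ^ S.card) •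
        ((List.ofFn u).map fun i => ∑ s ∈ Sᶜ, y i s).prod =
      ∑ r : Fin m → Fin d,
        if Function.Surjective r then (List.ofFn fun t => y (u t) (r t)).prod else 0 := by
  classical
  have hexp : ∀ S : Finset (Fin d), ((List.ofFn u).map fun i => ∑ s ∈ Sᶜ, y i s).prod =
      ∑ r : Fin m → Fin d, if S ⊆ (Finset.univ.image r)ᶜ then
        (List.ofFn fun t => y (u t) (r t)).prod else 0 := by
    intro S
    have := (MultilinearMap.mkPiAlgebraFin ℤ m A).map_sum_finset (fun t s => y (u t) s)
      (fun _ => Sᶜ)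
    simp only [MultilinearMap.mkPiAlgebraFin_apply] at this
    rw [List.map_ofFn]
    refine this.trans ?_
    rw [← Finset.sum_filter]
    refine Finset.sum_congr (Finset.ext fun r => ?_) fun _ _ => rfl
    simp only [Fintype.mem_piFinset, Finset.mem_compl, Finset.mem_filter, Finset.mem_univ,
      true_and, Finset.subset_iff, Finset.mem_image, not_exists]
    exact ⟨fun h s hs t ht => h t (ht ▸ hs), fun h t ht => h ht t rfl⟩
  simp only [hexp, Finset.smul_sum]
  rw [Finset.sum_comm]
  refine Finset.sum_congr rfl fun r _ => ?_
  simp only [smul_ite, smul_zero]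
  rw [← Finset.sum_filter, ← Finset.sum_smul]
  have : Finset.univ.filter (fun S => S ⊆ (Finset.univ.image r)ᶜ) =
      ((Finset.univ.image r)ᶜ).powerset := by ext; simp
  have hsurj : Finset.univ.image r = Finset.univ ↔ Function.Surjective r := by
    simp [Finset.eq_univ_iff_forall, Function.Surjective]
  simp only [this, Finset.sum_powerset_neg_one_pow_card, Finset.compl_eq_empty_iff, hsurj]
  split_ifs <;> simp

lemma sum_neg_one_pow_smul_map_prod {A ι : Type*} [Ring A] [DecidableEq ι] {d : ℕ}
    (w : Fin d → ι) (h : Fin d → A) (u : List ι) (hu : u.length ≤ d) :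
    ∑ S : Finset (Fin d), ((-1 : ℤ) ^ S.card) •
        (u.map fun i => ∑ s ∈ Sᶜ, if w s = i then h s else 0).prod =
      ∑ σ : Equiv.Perm (Fin d), if u = List.ofFn (w ∘ σ) then (List.ofFn (h ∘ σ)).prod else 0 := by
  obtain ⟨m, u, rfl⟩ : ∃ (m : ℕ) (u' : Fin m → ι), u = List.ofFn u' :=
    ⟨_, u.get, (List.ofFn_get u).symm⟩
  rw [List.length_ofFn] at hu
  rw [sum_neg_one_pow_smul_list_prod u fun i s => if w s = i then h s else 0]
  rcases hu.lt_or_eq with hlt | rfl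
  · rw [Finset.sum_eq_zero, Finset.sum_eq_zero]
    · intro σ _
      refine if_neg fun heq => hlt.ne ?_
      simpa using congrArg List.length heq
    · intro r _
      refine if_neg fun hr => hlt.not_ge ?_
      simpa using Fintype.card_le_of_surjective r hr
  · have hprod : ∀ r : Fin m → Fin m,
        (List.ofFn fun t => if w (r t) = u t then h (r t) else 0).prod =
          if List.ofFn u = List.ofFn (w ∘ r) then (List.ofFn (h ∘ r)).prod else 0 := by
      intro r
      split_ifs with hur
      · have hur : u = w ∘ r := List.ofFn_injective hur
        subst hur
        simp [Function.comp_def]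
      · obtain ⟨t, ht⟩ : ∃ t, w (r t) ≠ u t := by
          by_contra! hcon
          exact hur (congrArg List.ofFn (funext fun t => (hcon t).symm))
        refine List.prod_eq_zero ((List.mem_ofFn' _ _).2 ⟨t, if_neg ht⟩)
    simp only [hprod]
    rw [← Finset.sum_filter]
    symm
    refine Finset.sum_bij (fun σ _ => ⇑σ) (by simp [Equiv.surjective])
      (fun _ _ _ _ h => DFunLike.coe_injective h) (fun r hr => ?_) (fun _ _ => rfl)
    have hr : Function.Surjective r := (Finset.mem_filter.1 hr).2
    exact ⟨Equiv.ofBijective r (Finite.surjective_iff_bijective.1 hr), Finset.mem_univ _, rfl⟩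

lemma FreeAlgebra.lift_eq_sum {k X A : Type*} [CommSemiring k] [Semiring A] [Algebra k A]
    (v : X → A) (f : FreeAlgebra k X) :
    FreeAlgebra.lift k v f =
      (FreeAlgebra.equivMonoidAlgebraFreeMonoid f).coeff.sum
        fun u c => c • (u.toList.map v).prod := by
  have : FreeAlgebra.lift k v = (MonoidAlgebra.lift k A (FreeMonoid X) (FreeMonoid.lift v)).comp
      (FreeAlgebra.equivMonoidAlgebraFreeMonoid (R := k) (X := X)).toAlgHom := by
    ext x
    simp [FreeAlgebra.equivMonoidAlgebraFreeMonoid]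
  rw [this, AlgHom.comp_apply, MonoidAlgebra.lift_apply]
  simp only [FreeMonoid.lift_apply]
  rfl

/-- An algebra satisfying a polynomial identity satisfies a multilinear one. -/
lemma SatisfiesPolynomialIdentity.exists_multilinear {k : Type u} {A : Type v} [CommRing k]
    [Ring A] [Algebra k A] (hA : SatisfiesPolynomialIdentity k A) :
    ∃ (d : ℕ) (a : Equiv.Perm (Fin d) → k), a 1 ≠ 0 ∧
      ∀ h : Fin d → A, ∑ σ, a σ • (List.ofFn (h ∘ σ)).prod = 0 := by
  obtain ⟨n, f, hf, hfA⟩ := hA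
  set c := (FreeAlgebra.equivMonoidAlgebraFreeMonoid f).coeff with hc
  have hc0 : c ≠ 0 := by simpa [hc] using hf
  obtain ⟨w, hw, hmax⟩ := c.support.exists_max_image (fun u => u.toList.length)
    (Finsupp.support_nonempty_iff.2 hc0)
  refine ⟨w.toList.length, fun σ => c (FreeMonoid.ofList (List.ofFn (w.toList.get ∘ σ))), ?_,
    fun h => ?_⟩
  · have : List.ofFn (w.toList.get ∘ ⇑(1 : Equiv.Perm (Fin w.toList.length))) = w.toList := by
      simp
    simpa only [this, FreeMonoid.ofList_toList, Finsupp.mem_support_iff] using hw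
  · have key := Finset.sum_eq_zero fun (S : Finset (Fin w.toList.length)) (_ : S ∈ Finset.univ) =>
      show ((-1 : ℤ) ^ S.card) • FreeAlgebra.lift k
        (fun i => ∑ s ∈ Sᶜ, if w.toList.get s = i then h s else 0) f = 0 by rw [hfA, smul_zero]
    simp only [FreeAlgebra.lift_eq_sum, ← hc, Finsupp.sum, Finset.smul_sum] at key
    rw [Finset.sum_comm] at key
    simp only [smul_comm _ (c _)] at key
    simp only [← Finset.smul_sum] at key
    rw [Finset.sum_congr rfl fun u hu => by
      rw [sum_neg_one_pow_smul_map_prod w.toList.get h u.toList (hmax u hu)]] at key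
    simp only [Finset.smul_sum, smul_ite, smul_zero] at key
    rw [Finset.sum_comm] at key
    rw [← key]
    refine Finset.sum_congr rfl fun σ _ => ?_
    rw [Finset.sum_eq_single (FreeMonoid.ofList (List.ofFn (w.toList.get ∘ σ)))]
    · simp
    · intro u _ hu
      exact if_neg fun h => hu (by rw [← h]; rfl)
    · intro hu
      simp [Finsupp.notMem_support_iff.1 hu]

end Multilinearization
section NoetherianPI

lemma MonoidAlgebra.finiteIndex_fcCenter {k : Type u} [CommRing k] [Nontrivial k] {G : Type v}
    [Group G] (h : SatisfiesPolynomialIdentity k (MonoidAlgebra k G)) :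
    (fcCenter G).FiniteIndex := by
  by_contra hfin
  obtain ⟨d, a, ha, hmul⟩ := h.exists_multilinear
  obtain ⟨g, -, hg⟩ := exists_generic_of_not_finiteIndex_fcCenter hfin (List.finRange d)
    (List.nodup_finRange d)
  have key := congrArg (fun x => x.coeff (List.ofFn g).prod)
    (hmul fun i => MonoidAlgebra.of k G (g i))
  have hof : ∀ σ : Equiv.Perm (Fin d),
      (List.ofFn ((fun i => MonoidAlgebra.of k G (g i)) ∘ σ)).prod =
        MonoidAlgebra.of k G (List.ofFn (g ∘ σ)).prod := by
    intro σ
    rw [map_list_prod, List.map_ofFn]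
    rfl
  simp only [hof] at key
  simp only [MonoidAlgebra.of_apply, MonoidAlgebra.smul_single, MonoidAlgebra.coeff_sum,
    MonoidAlgebra.coeff_single, Finsupp.finsetSum_apply, smul_eq_mul, mul_one] at key
  rw [Finset.sum_eq_single 1] at key
  · exact ha (by simpa using key)
  · intro σ _ hσ
    refine Finsupp.single_eq_of_ne' fun heq => hσ ?_
    have := hg (List.ofFn σ) (by
      rw [← List.ofFn_id]
      exact Equiv.Perm.ofFn_comp_perm σ id) (by simpa [List.map_ofFn, ← List.ofFn_eq_map] using heq)
    rw [← List.ofFn_id, List.ofFn_inj] at this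
    exact Equiv.ext fun i => congrFun this i
  · simp

lemma exists_isMulCommutative_of_finiteIndex_fcCenter {G : Type*} [Group G] [Group.FG G]
    (h : (fcCenter G).FiniteIndex) : ∃ A : Subgroup G, IsMulCommutative A ∧ A.FiniteIndex := by
  obtain ⟨S, hS⟩ := (Group.fg_iff_subgroup_fg (fcCenter G)).1 inferInstance
  refine ⟨fcCenter G ⊓ Subgroup.centralizer (S : Set G), ⟨⟨fun x y => Subtype.ext ?_⟩⟩, ?_⟩
  · have hx := x.2.1
    have hy : (y : G) ∈ Subgroup.centralizer (S : Set G) := y.2.2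
    have hle : Subgroup.centralizer (S : Set G) ≤ Subgroup.centralizer (fcCenter G) := by
      rw [← Subgroup.centralizer_closure, hS]
    exact Subgroup.mem_centralizer_iff.1 (hle hy) _ hx
  · have : (Subgroup.centralizer (S : Set G)).FiniteIndex := by
      have heq : Subgroup.centralizer (S : Set G) = ⨅ s : S, Subgroup.centralizer {(s : G)} := by
        ext z
        simp [Subgroup.mem_iInf, Subgroup.mem_centralizer_iff]
      rw [heq]
      refine Subgroup.finiteIndex_iInf fun s => mem_fcCenter.1 ?_
      rw [← hS]
      exact Subgroup.subset_closure s.2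
    infer_instance

/-- The left ideal of the group algebra generated by the elements `h - 1` with `h ∈ H`. -/
noncomputable def MonoidAlgebra.augmentationLeftIdeal (k : Type*) [CommRing k] {G : Type*} [Group G]
    (H : Subgroup G) : Submodule (MonoidAlgebra k G) (MonoidAlgebra k G) :=
  Submodule.span _ ((fun h => MonoidAlgebra.of k G h - 1) '' H)

lemma MonoidAlgebra.of_sub_one_mem_augmentationLeftIdeal_iff {k : Type*} [CommRing k]
    [Nontrivial k] {G : Type*} [Group G] {H : Subgroup G} {g : G} :
    MonoidAlgebra.of k G g - 1 ∈ augmentationLeftIdeal k H ↔ g ∈ H := by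
  refine ⟨fun hg => ?_, fun hg => Submodule.subset_span ⟨g, hg, rfl⟩⟩
  let φ : MonoidAlgebra k G →ₗ[k] (G ⧸ H →₀ k) :=
    Finsupp.lmapDomain k k (QuotientGroup.mk : G → G ⧸ H) ∘ₗ
      (MonoidAlgebra.coeffLinearEquiv k).toLinearMap
  have hφ : ∀ x r, φ (MonoidAlgebra.single x r) = Finsupp.single (x : G ⧸ H) r := by
    intro x r
    simp [φ]
  have hker : ∀ x ∈ augmentationLeftIdeal k H, φ x = 0 := by
    intro x hx
    refine Submodule.closure_induction (p := fun x _ => φ x = 0) (by simp)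
      (fun x y _ _ hx hy => by simp [hx, hy]) ?_ hx
    rintro r _ ⟨h, hh, rfl⟩
    induction r using MonoidAlgebra.induction_linear with
    | zero => simp
    | add r s hr hs => rw [add_smul, map_add, hr, hs, add_zero]
    | single x r =>
      rw [smul_eq_mul, mul_sub, mul_one, MonoidAlgebra.of_apply, MonoidAlgebra.single_mul_single,
        map_sub, hφ, hφ, mul_one, sub_eq_zero, QuotientGroup.mk_mul_of_mem x hh]
  have := hker _ hg
  rw [map_sub, MonoidAlgebra.of_apply, MonoidAlgebra.one_def, hφ, hφ, sub_eq_zero,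
    Finsupp.single_left_inj one_ne_zero, eq_comm, QuotientGroup.eq] at this
  simpa using this

lemma MonoidAlgebra.group_fg_of_isNoetherianRing {k : Type*} [CommRing k] [Nontrivial k]
    {G : Type*} [Group G] [IsNoetherianRing (MonoidAlgebra k G)] : Group.FG G := by
  obtain ⟨_, ⟨H, hH, rfl⟩, hmax⟩ := set_has_maximal_iff_noetherian.2
    (inferInstance : IsNoetherianRing (MonoidAlgebra k G))
    (augmentationLeftIdeal k '' {H : Subgroup G | H.FG}) ⟨_, ⊥, Subgroup.FG.bot, rfl⟩
  refine ⟨?_⟩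
  convert! hH
  refine (eq_top_iff.2 fun g _ => ?_).symm
  have hle : augmentationLeftIdeal k H ≤ augmentationLeftIdeal k (H ⊔ Subgroup.zpowers g) :=
    Submodule.span_mono (Set.image_mono (le_sup_left : H ≤ H ⊔ Subgroup.zpowers g))
  have hfg : (H ⊔ Subgroup.zpowers g).FG :=
    Subgroup.FG.sup hH ⟨{g}, by simp [Subgroup.zpowers_eq_closure]⟩
  have heq := (hle.lt_or_eq).resolve_left (hmax _ ⟨_, hfg, rfl⟩)
  rw [← of_sub_one_mem_augmentationLeftIdeal_iff (k := k), heq,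
    of_sub_one_mem_augmentationLeftIdeal_iff]
  exact le_sup_right (a := H) (Subgroup.mem_zpowers g)

end NoetherianPI

section StandardIdentity

lemma AlternatingMap.eq_zero_of_span_eq_top {C M M' : Type*} [CommRing C] [AddCommGroup M]
    [Module C M] [AddCommGroup M'] [Module C M'] {m n : ℕ} {s : Fin m → M}
    (hs : Submodule.span C (Set.range s) = ⊤) (hmn : m < n) (f : M [⋀^Fin n]→ₗ[C] M') :
    f = 0 := by
  ext v
  have hv : ∀ i, ∃ c : Fin m → C, ∑ j, c j • s j = v i := fun i =>
    (Submodule.mem_span_range_iff_exists_fun C).1 (hs ▸ Submodule.mem_top)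
  choose c hc using hv
  have hexp := f.toMultilinearMap.map_sum (fun i j => c i j • s j)
  simp only [hc] at hexp
  refine hexp.trans (Finset.sum_eq_zero fun r _ => ?_)
  refine (f.toMultilinearMap.map_smul_univ (fun i => c i (r i)) (fun i => s (r i))).trans ?_
  obtain ⟨i, j, hne, hij⟩ := Fintype.exists_ne_map_eq_of_card_lt r (by simpa using hmn)
  have h0 : f (fun i => s (r i)) = 0 := f.map_eq_zero_of_eq _ (by simp [hij]) hne
  exact (congrArg _ h0).trans (smul_zero _)

/-- The standard polynomial `∑ σ, sign σ • X (σ 0) * ⋯ * X (σ (n - 1))`. -/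
noncomputable def standardPolynomial (k : Type*) [CommRing k] (n : ℕ) : FreeAlgebra k (Fin n) :=
  ∑ σ : Equiv.Perm (Fin n), (Equiv.Perm.sign σ : ℤ) • (List.ofFn (FreeAlgebra.ι k ∘ σ)).prod

lemma lift_standardPolynomial {k A : Type*} [CommRing k] [Ring A] [Algebra k A] {n : ℕ}
    (x : Fin n → A) : FreeAlgebra.lift k x (standardPolynomial k n) =
      ∑ σ : Equiv.Perm (Fin n), (Equiv.Perm.sign σ : ℤ) • (List.ofFn (x ∘ σ)).prod := by
  simp only [standardPolynomial, map_sum, map_zsmul, map_list_prod, List.map_ofFn]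
  refine Finset.sum_congr rfl fun σ _ => ?_
  congr 3
  ext i
  simp

lemma standardPolynomial_ne_zero (k : Type*) [CommRing k] [Nontrivial k] (n : ℕ) :
    standardPolynomial k n ≠ 0 := by
  intro h0
  let x : Fin n → MonoidAlgebra k (FreeMonoid (Fin n)) := fun i => .of _ _ (.of i)
  have h := lift_standardPolynomial (k := k) x
  rw [h0, map_zero] at h
  have hx : ∀ σ : Equiv.Perm (Fin n), (List.ofFn (x ∘ σ)).prod =
      MonoidAlgebra.of k _ (FreeMonoid.ofList (List.ofFn σ)) := by
    intro σ
    have hσ : FreeMonoid.ofList (List.ofFn σ) = (List.ofFn (FreeMonoid.of ∘ σ)).prod := by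
      rw [← List.map_ofFn]
      induction List.ofFn σ with
      | nil => rfl
      | cons a l ih => rw [List.map_cons, List.prod_cons, ← ih, FreeMonoid.ofList_cons]
    rw [hσ, map_list_prod, List.map_ofFn]
    rfl
  have key := congrArg (fun y => y.coeff (FreeMonoid.ofList (List.ofFn (id : Fin n → Fin n)))) h
  simp only [hx] at key
  simp only [MonoidAlgebra.of_apply, MonoidAlgebra.coeff_sum, MonoidAlgebra.coeff_zero,
    Finsupp.finsetSum_apply, Finsupp.zero_apply, MonoidAlgebra.smul_single,
    MonoidAlgebra.coeff_single] at key
  rw [Finset.sum_eq_single 1] at key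
  · simp at key
  · intro σ _ hσ
    refine Finsupp.single_eq_of_ne' fun heq => hσ (Equiv.ext fun i => ?_)
    exact congrFun (List.ofFn_injective (FreeMonoid.ofList.injective heq)) i
  · simp

lemma SatisfiesPolynomialIdentity.of_module_finite {k : Type u} [CommRing k] [Nontrivial k]
    {A : Type v} [Ring A] [Algebra k A] (C : Type*) [CommRing C] [Algebra C A]
    [Module.Finite C A] : SatisfiesPolynomialIdentity k A := by
  obtain ⟨m, s, hs⟩ := Module.Finite.exists_fin (R := C) (M := A)
  refine ⟨m + 1, standardPolynomial k (m + 1), standardPolynomial_ne_zero k _, fun x => ?_⟩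
  have := DFunLike.congr_fun (AlternatingMap.eq_zero_of_span_eq_top hs m.lt_succ_self
    (MultilinearMap.alternatization (MultilinearMap.mkPiAlgebraFin C (m + 1) A))) x
  rw [MultilinearMap.alternatization_apply] at this
  rw [lift_standardPolynomial]
  simpa [MultilinearMap.mkPiAlgebraFin_apply, Function.comp_def, Units.smul_def] using this

lemma SatisfiesPolynomialIdentity.of_injective {k : Type u} [CommRing k] {A B : Type*} [Ring A]
    [Algebra k A] [Ring B] [Algebra k B] (h : SatisfiesPolynomialIdentity k B) (φ : A →ₐ[k] B)
    (hφ : Function.Injective φ) : SatisfiesPolynomialIdentity k A := by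
  obtain ⟨n, f, hf, h⟩ := h
  refine ⟨n, f, hf, fun x => hφ ?_⟩
  rw [map_zero, ← h (φ ∘ x), ← AlgHom.comp_apply]
  congr 1
  ext
  simp

/-- A ring that is finitely generated as a left module over a commutative noetherian subring
satisfies a polynomial identity. -/
lemma SatisfiesPolynomialIdentity.of_isNoetherian {k : Type u} [CommRing k] [Nontrivial k]
    {A : Type v} [Ring A] [Algebra k A] (C : Type*) [CommRing C] [Algebra k C] [Module C A]
    [IsScalarTower C A A] [IsScalarTower k C A] [IsNoetherianRing C] [Module.Finite C A] :
    SatisfiesPolynomialIdentity k A := by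
  have : SMulCommClass Aᵐᵒᵖ C A := ⟨fun a c x => (smul_mul_assoc c x a.unop).symm ▸ rfl⟩
  have : SMulCommClass C k A := ⟨fun c r x => by
    rw [← algebraMap_smul C r (c • x), ← algebraMap_smul C r x, smul_smul, smul_smul, mul_comm]⟩
  have hfin : Module.Finite C (Module.End C A) := inferInstance
  have : Module.Finite C (Module.End C A)ᵐᵒᵖ := .equiv (MulOpposite.opLinearEquiv C)
  refine (SatisfiesPolynomialIdentity.of_module_finite (A := (Module.End C A)ᵐᵒᵖ) C).of_injective
    (AlgHom.opComm.symm (Algebra.lsmul k C A (A := Aᵐᵒᵖ))) fun x y hxy => ?_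
  have := congrArg (fun φ : (Module.End C A)ᵐᵒᵖ => φ.unop (1 : A)) hxy
  simpa using this

end StandardIdentity

section Converse

/-- If `A` is a finite index subgroup of `G`, then `k[G]` is finitely generated as a left
`k[A]`-module. -/
lemma MonoidAlgebra.module_finite_of_finiteIndex {k : Type*} [CommRing k] {G : Type*} [Group G]
    {A : Subgroup G} (hA : A.FiniteIndex) [Module (MonoidAlgebra k A) (MonoidAlgebra k G)]
    (hsmul : ∀ (c : MonoidAlgebra k A) (x : MonoidAlgebra k G),
      c • x = mapDomainRingHom k A.subtype c * x) :
    Module.Finite (MonoidAlgebra k A) (MonoidAlgebra k G) := by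
  refine ⟨⟨(Set.finite_range fun q : G ⧸ A => of k G (q.out)⁻¹).toFinset, ?_⟩⟩
  rw [Set.Finite.coe_toFinset, eq_top_iff]
  rintro x -
  induction x using MonoidAlgebra.induction_linear with
  | zero => exact zero_mem _
  | add x y hx hy => exact add_mem hx hy
  | single g r =>
    set q : G ⧸ A := ((g⁻¹ : G) : G ⧸ A) with hq
    have hmem : g * q.out ∈ A := by
      have := QuotientGroup.eq.1 (hq.symm.trans q.out_eq'.symm)
      simpa using this
    have : (single g r : MonoidAlgebra k G) =
        (single ⟨g * q.out, hmem⟩ r : MonoidAlgebra k A) • of k G (q.out)⁻¹ := by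
      rw [hsmul]
      simp
    rw [this]
    exact Submodule.smul_mem _ _ (Submodule.subset_span ⟨q, rfl⟩)

lemma MonoidAlgebra.isNoetherianRing_and_satisfiesPolynomialIdentity {k : Type u} [Field k]
    {G : Type v} [Group G] [Group.FG G] {A : Subgroup G} (hcomm : IsMulCommutative A)
    (hA : A.FiniteIndex) : IsNoetherianRing (MonoidAlgebra k G) ∧
      SatisfiesPolynomialIdentity k (MonoidAlgebra k G) := by
  let _ : CommGroup A := { (inferInstance : Group A) with mul_comm := hcomm.is_comm.comm }
  let _ : Module (MonoidAlgebra k A) (MonoidAlgebra k G) :=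
    Module.compHom _ (mapDomainRingHom k A.subtype)
  have hsmul : ∀ (c : MonoidAlgebra k A) (x : MonoidAlgebra k G),
      c • x = mapDomainRingHom k A.subtype c * x := fun _ _ => rfl
  have : Module.Finite (MonoidAlgebra k A) (MonoidAlgebra k G) :=
    module_finite_of_finiteIndex hA hsmul
  have : IsScalarTower (MonoidAlgebra k A) (MonoidAlgebra k G) (MonoidAlgebra k G) :=
    ⟨fun c x y => mul_assoc (mapDomainRingHom k A.subtype c) x y⟩
  have : IsScalarTower k (MonoidAlgebra k A) (MonoidAlgebra k G) := ⟨fun r c x => by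
    have : mapDomainRingHom k A.subtype (r • c) = r • mapDomainRingHom k A.subtype c :=
      map_smul (mapDomainAlgHom k k A.subtype) r c
    rw [hsmul, hsmul, this, smul_mul_assoc]⟩
  have : Monoid.FG A := Group.fg_iff_monoid_fg.1 (Subgroup.fg_of_index_ne_zero A)
  have : IsNoetherianRing (MonoidAlgebra k A) := Algebra.FiniteType.isNoetherianRing k _
  exact ⟨isNoetherian_of_tower (MonoidAlgebra k A) inferInstance,
    .of_isNoetherian (MonoidAlgebra k A)⟩

/-- Inversion of group elements identifies a group algebra with its opposite. -/
noncomputable def MonoidAlgebra.ringEquivMulOpposite (k G : Type*) [CommRing k] [Group G] :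
    MonoidAlgebra k G ≃+* (MonoidAlgebra k G)ᵐᵒᵖ :=
  ((mapRingEquiv G (RingEquiv.toOpposite k)).trans
    (mapDomainRingEquiv kᵐᵒᵖ (MulEquiv.inv' G))).trans MonoidAlgebra.opRingEquiv.symm

end Converse

theorem group_algebra_noetherian_PI_iff_fg_abelian_by_finite
    (k : Type u) [Field k] (G : Type v) [Group G] :
    (IsNoetherianRing (MonoidAlgebra k G) ∧ IsNoetherianRing (MonoidAlgebra k G)ᵐᵒᵖ ∧
        SatisfiesPolynomialIdentity k (MonoidAlgebra k G)) ↔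
      (Group.FG G ∧ ∃ A : Subgroup G, IsMulCommutative A ∧ A.FiniteIndex) := by
  constructor
  · rintro ⟨_, -, hPI⟩
    have : Group.FG G := MonoidAlgebra.group_fg_of_isNoetherianRing (k := k)
    exact ⟨this, exists_isMulCommutative_of_finiteIndex_fcCenter
      (MonoidAlgebra.finiteIndex_fcCenter hPI)⟩
  · rintro ⟨_, A, hcomm, hA⟩
    obtain ⟨hN, hPI⟩ :=
      MonoidAlgebra.isNoetherianRing_and_satisfiesPolynomialIdentity (k := k) hcomm hA
    exact ⟨hN, isNoetherianRing_of_ringEquiv _ (MonoidAlgebra.ringEquivMulOpposite k G), hPI⟩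
end
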